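/- The integral over the simplex Δ of xy/(1-x²-y²) dx dy equals (1 - log 2)/4. -/

import Mathlib

open MeasureTheory

lemma aux_inner (x : ℝ) (h0 : 0 < x) (h1 : x < 1) :
    ∫ y in (0:ℝ)..(1 - x), x * y / (1 - x ^ 2 - y ^ 2) =
      x / 2 * (Real.log (1 + x) - Real.log 2 - Real.log x) := by
  have hpos : ∀ y ∈ Set.uIcc 0 (1 - x), 0 < 1 - x ^ 2 - y ^ 2 := by
    intro y hy
    rw [Set.uIcc_of_le (by linarith)] at hy
    obtain ⟨ha, hb⟩ := hy
    nlinarith [mul_pos h0 (sub_pos.2 h1)]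
  rw [intervalIntegral.integral_eq_sub_of_hasDerivAt
    (f := fun y => -(x / 2) * Real.log (1 - x ^ 2 - y ^ 2))]
  · have e1 : 1 - x ^ 2 - (1 - x) ^ 2 = 2 * x * (1 - x) := by ring
    have e2 : 1 - x ^ 2 - 0 ^ 2 = (1 + x) * (1 - x) := by ring
    have : 1 - x ≠ 0 := by linarith
    simp only [e1, e2]
    rw [Real.log_mul (by positivity) this, Real.log_mul (by positivity) this,
      Real.log_mul (by positivity) (by positivity)]
    ring
  · intro y hy
    have hp := (hpos y hy).ne'
    have h := ((((hasDerivAt_id y).pow 2).const_sub (1 - x ^ 2)).log hp).const_mul (-(x / 2))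
    refine HasDerivAt.congr_deriv h ?_
    simp
    field_simp
  · apply ContinuousOn.intervalIntegrable
    apply ContinuousOn.div (by fun_prop) (by fun_prop)
    intro y hy
    exact (hpos y hy).ne'

lemma aux_outer : ∫ x in (0:ℝ)..1, x / 2 * (Real.log (1 + x) - Real.log 2 - Real.log x) =
    (1 - Real.log 2) / 4 := by
  rw [intervalIntegral.integral_eq_sub_of_hasDerivAt_of_le zero_le_one
    (f := fun x => 1 / 2 * ((x ^ 2 - 1) / 2 * Real.log (1 + x) + x / 2 - x ^ 2 / 2 * Real.log 2
      - x / 2 * (x * Real.log x)))]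
  · norm_num
    ring
  · have := Real.continuous_mul_log
    have h2 : ContinuousOn (fun x : ℝ => Real.log (1 + x)) (Set.Icc 0 1) := by
      apply ContinuousOn.log (by fun_prop)
      intro x hx
      linarith [hx.1]
    fun_prop
  · intro x hx
    have hx0 : x ≠ 0 := hx.1.ne'
    have hx1 : 1 + x ≠ 0 := by linarith [hx.1]
    have hl := ((hasDerivAt_id x).const_add 1).log hx1
    have h := ((((((((hasDerivAt_id x).pow 2).sub_const 1).div_const 2).mul hl).add
      ((hasDerivAt_id x).div_const 2)).sub
      ((((hasDerivAt_id x).pow 2).div_const 2).mul_const (Real.log 2))).sub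
      (((hasDerivAt_id x).div_const 2).mul ((hasDerivAt_id x).mul (Real.hasDerivAt_log hx0)))).const_mul (1/2)
    refine HasDerivAt.congr_deriv h ?_
    simp
    field_simp
    ring
  · have h2 : ContinuousOn (fun x : ℝ => Real.log (1 + x)) (Set.uIcc 0 1) := by
      apply ContinuousOn.log (by fun_prop)
      intro x hx
      rw [Set.uIcc_of_le zero_le_one] at hx
      linarith [hx.1]
    have := Real.continuous_mul_log
    apply ContinuousOn.intervalIntegrable
    have : ContinuousOn (fun x : ℝ => x / 2 * (Real.log (1 + x) - Real.log 2) - 1/2 * (x * Real.log x))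
      (Set.uIcc 0 1) :=
      ((continuousOn_id.div_const 2).mul (h2.sub continuousOn_const)).sub
        (continuousOn_const.mul this.continuousOn)
    refine this.congr fun x _ => ?_
    ring

/-- `∫_Δ xy/(1-x²-y²) dxdy = (1 - log 2)/4`. -/
theorem integral_simplex_xy :
    ∫ p : ℝ × ℝ in {p : ℝ × ℝ | 0 ≤ p.1 ∧ 0 ≤ p.2 ∧ 0 ≤ 1 - p.1 - p.2},
        p.1 * p.2 / (1 - p.1 ^ 2 - p.2 ^ 2) =
      (1 - Real.log 2) / 4 := by
  set S := {p : ℝ × ℝ | 0 ≤ p.1 ∧ 0 ≤ p.2 ∧ 0 ≤ 1 - p.1 - p.2} with hS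
  have hSm : MeasurableSet S := by
    apply IsClosed.measurableSet
    have c1 : IsClosed {p : ℝ × ℝ | 0 ≤ p.1} := isClosed_le (by fun_prop) (by fun_prop)
    have c2 : IsClosed {p : ℝ × ℝ | 0 ≤ p.2} := isClosed_le (by fun_prop) (by fun_prop)
    have c3 : IsClosed {p : ℝ × ℝ | 0 ≤ 1 - p.1 - p.2} := isClosed_le (by fun_prop) (by fun_prop)
    exact c1.inter (c2.inter c3)
  have hint : IntegrableOn (fun p : ℝ × ℝ => p.1 * p.2 / (1 - p.1 ^ 2 - p.2 ^ 2)) S := by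
    have hfin : volume S < ⊤ := by
      apply lt_of_le_of_lt (measure_mono (t := Set.Icc ((0:ℝ), (0:ℝ)) (1, 1)) _)
        isCompact_Icc.measure_lt_top
      rintro ⟨x, y⟩ ⟨h1, h2, h3⟩
      simp only at h1 h2 h3
      exact ⟨⟨h1, h2⟩, ⟨by simp only; linarith, by simp only; linarith⟩⟩
    refine Measure.integrableOn_of_bounded (M := 1/2) hfin.ne ?_ ?_
    · exact Measurable.aestronglyMeasurable (by fun_prop)
    · refine (ae_restrict_iff' hSm).2 (Filter.Eventually.of_forall ?_)
      rintro ⟨x, y⟩ ⟨h1, h2, h3⟩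
      simp only at h1 h2 h3 ⊢
      have hxy := mul_nonneg h1 h2
      have hd : 2 * (x * y) ≤ 1 - x ^ 2 - y ^ 2 := by nlinarith
      rw [Real.norm_of_nonneg (div_nonneg hxy (by linarith))]
      apply div_le_of_le_mul₀ (by linarith) (by norm_num)
      linarith
  rw [← integral_indicator hSm, Measure.volume_eq_prod, integral_prod]
  swap
  · exact (integrable_indicator_iff hSm).2 hint
  rw [← aux_outer, intervalIntegral.integral_of_le zero_le_one,
    ← integral_indicator measurableSet_Ioc]
  congr 1
  ext x
  by_cases hx : 0 < x ∧ x < 1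
  · rw [Set.indicator_of_mem (show x ∈ Set.Ioc (0:ℝ) 1 from ⟨hx.1, hx.2.le⟩), ← aux_inner x hx.1 hx.2,
      intervalIntegral.integral_of_le (by linarith [hx.2]), ← integral_Icc_eq_integral_Ioc,
      ← integral_indicator measurableSet_Icc]
    congr 1
    ext y
    have : (x, y) ∈ S ↔ y ∈ Set.Icc 0 (1 - x) := by
      simp only [hS, Set.mem_ofPred_eq, Set.mem_Icc]
      constructor
      · rintro ⟨_, h2, h3⟩
        exact ⟨h2, by linarith⟩
      · rintro ⟨h2, h3⟩
        exact ⟨hx.1.le, h2, by linarith⟩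
    simp only [Set.indicator, this]
  · have hr : (Set.Ioc (0:ℝ) 1).indicator
        (fun x => x / 2 * (Real.log (1 + x) - Real.log 2 - Real.log x)) x = 0 := by
      apply Set.indicator_apply_eq_zero.2
      rintro ⟨h1, h2⟩
      have : x = 1 := by
        by_contra h
        exact hx ⟨h1, lt_of_le_of_ne h2 h⟩
      subst this
      norm_num
    rw [hr]
    apply integral_eq_zero_of_ae
    refine Filter.Eventually.of_forall fun y => ?_
    apply Set.indicator_apply_eq_zero.2
    rintro ⟨h1, h2, h3⟩
    simp only at h1 h2 h3 ⊢
    rcases h1.eq_or_lt with h | h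
    · simp [← h]
    · have : 1 ≤ x := by
        by_contra h'
        exact hx ⟨h, not_le.1 h'⟩
      have : y = 0 := by linarith
      simp [this]
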